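/- Let M be a structural equation model (SEM) over a DAG G=(V,E) with finite discrete variables, observed variables N ⊆ V, control variables C ⊆ Λ_G (the observed roots of G), and strictly positive observational distribution P^M(N). Let (Y,X) ∈ E and c ∈ D_C be such that under the intervention do(C=c) the structural function of X does not depend on Y, and let H be the DAG obtained by removing the edge (Y,X) from G. If (I) both X and Y are observed (X, Y ∈ N) and (II) X and Y are d-separable in H by some subset of N, then the context-specific independence relation X ⟂ Y | C=c, (Anc_{{X,Y}} ∩ N \ C) \ {X,Y} holds in P^M, where Anc_{{X,Y}} denotes the union of ancestors (including themselves) of X and Y in H; hence this CSI relation can be verified from the observational distribution P^M(N) alone. -/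

import Mathlib

open Finset

/-- A structural equation model (SEM) over the directed graph `E` on the finite
vertex type `V`, with finite discrete domains `D v`.  Each vertex `v` has a finite
noise domain `Fin (noiseCard v)` with distribution `noiseDist v` (the noises are
jointly independent, so the joint noise weight is the product of the marginals),
and a structural function `f v` that may only depend on the parents of `v`. -/
structure SEM (V : Type) [Fintype V] [DecidableEq V]
    (E : V → V → Prop) (D : V → Type)
    [∀ v, Fintype (D v)] [∀ v, DecidableEq (D v)] : Type where
  noiseCard : V → ℕ
  noisePos : ∀ v, 0 < noiseCard v
  noiseDist : ∀ v, Fin (noiseCard v) → ℝ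
  noiseDist_nonneg : ∀ v n, 0 ≤ noiseDist v n
  noiseDist_sum_one : ∀ v, ∑ n, noiseDist v n = 1
  f : ∀ v, (∀ u, D u) → Fin (noiseCard v) → D v
  f_parents : ∀ v (g g' : ∀ u, D u) n,
    (∀ u, E u v → g u = g' u) → f v g n = f v g' n

/-- The relation `E` has no directed cycles (so a finite graph is a DAG). -/
def Acyclic {V : Type} (E : V → V → Prop) : Prop :=
  ∀ v, ¬ Relation.TransGen E v v

/-- A vertex is a root if it has no parents. -/
def IsRoot {V : Type} (E : V → V → Prop) (v : V) : Prop := ∀ u, ¬ E u v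

namespace SEM

variable {V : Type} [Fintype V] [DecidableEq V] {E : V → V → Prop}
  {D : V → Type} [∀ v, Fintype (D v)] [∀ v, DecidableEq (D v)]

/-- The joint noise outcome space of a SEM. -/
abbrev Ω (M : SEM V E D) : Type := ∀ v, Fin (M.noiseCard v)

/-- The probability of a joint noise outcome (noises are jointly independent). -/
noncomputable def W (M : SEM V E D) (ω : M.Ω) : ℝ :=
  ∏ v, M.noiseDist v (ω v)

/-- `g` solves the structural equations under the intervention `do(T = t)`
(only the values of `t` on `T` are relevant): intervened variables are forced to
their assigned values and every other variable is generated by its equation. -/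
def IsSolution (M : SEM V E D) (T : Set V) (t : ∀ v, D v)
    (g : M.Ω → ∀ v, D v) : Prop :=
  ∀ ω v, (v ∈ T → g ω v = t v) ∧ (v ∉ T → g ω v = M.f v (g ω) (ω v))

/-- `g` solves the structural equations with no intervention. -/
def IsObsSolution (M : SEM V E D) (g : M.Ω → ∀ v, D v) : Prop :=
  ∀ ω v, g ω v = M.f v (g ω) (ω v)

/-- The probability of the event `A` under the solution map `g`. -/
noncomputable def prob (M : SEM V E D) (g : M.Ω → ∀ v, D v)
    (A : (∀ v, D v) → Prop) : ℝ :=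
  letI := Classical.decPred fun ω : M.Ω => A (g ω)
  ∑ ω ∈ Finset.univ.filter (fun ω : M.Ω => A (g ω)), M.W ω

/-- `X ⟂ Y | S` within the context `ctx`, for the distribution induced by the
solution map `g`: the standard cross-multiplied form of conditional independence
of two discrete variables given the variables in `S` (in the context `ctx`). -/
def CondIndepOn (M : SEM V E D) (g : M.Ω → ∀ v, D v)
    (X Y : V) (S : Set V) (ctx : (∀ v, D v) → Prop) : Prop :=
  ∀ (x : D X) (y : D Y) (s : ∀ v, D v),
    M.prob g (fun w => w X = x ∧ w Y = y ∧ (∀ v ∈ S, w v = s v) ∧ ctx w) *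
        M.prob g (fun w => (∀ v ∈ S, w v = s v) ∧ ctx w) =
      M.prob g (fun w => w X = x ∧ (∀ v ∈ S, w v = s v) ∧ ctx w) *
        M.prob g (fun w => w Y = y ∧ (∀ v ∈ S, w v = s v) ∧ ctx w)

end SEM

/-- All ancestors of `X` in the graph `E` (including `X` itself). -/
def Ancestors {V : Type} (E : V → V → Prop) (X : V) : Set V :=
  {u | Relation.ReflTransGen E u X}

/-- `p` is an (undirected) path in the graph `E`: consecutive vertices are
adjacent (in either direction) and no vertex repeats. -/
def IsPath {V : Type} (E : V → V → Prop) (p : List V) : Prop :=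
  p.Chain' (fun u v => E u v ∨ E v u) ∧ p.Nodup

/-- The vertex at interior position `i` of the path `p` is a collider:
both neighboring edges on the path point into it. -/
def CollidesAt {V : Type} (E : V → V → Prop) (p : List V) (i : ℕ) : Prop :=
  0 < i ∧ i + 1 < p.length ∧
    ∃ a b c, p[i - 1]? = some a ∧ p[i]? = some b ∧ p[i + 1]? = some c ∧
      E a b ∧ E c b

/-- The path `p` is blocked by the set `S`: it contains an interior non-collider
belonging to `S`, or an interior collider that is neither in `S` nor an ancestor
of any member of `S`. -/
def Blocked {V : Type} (E : V → V → Prop) (S : Set V) (p : List V) : Prop :=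
  ∃ i b, 0 < i ∧ i + 1 < p.length ∧ p[i]? = some b ∧
    ((¬ CollidesAt E p i ∧ b ∈ S) ∨
      (CollidesAt E p i ∧ b ∉ S ∧ ∀ s ∈ S, b ∉ Ancestors E s))

/-- `X` and `Y` are d-separated by `S` in the graph `E`:
every path between them is blocked by `S`. -/
def DSep {V : Type} (E : V → V → Prop) (X Y : V) (S : Set V) : Prop :=
  ∀ p : List V, IsPath E p → p.head? = some X → p.getLast? = some Y →
    Blocked E S p

/-- A path `p` between the observed vertices `X` and `Y` is an inducing path
(w.r.t. the observed set `N`): every interior observed vertex is a collider,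
and every interior collider is an ancestor of `X` or of `Y`. -/
def IsInducingPath {V : Type} (E : V → V → Prop) (N : Set V) (X Y : V)
    (p : List V) : Prop :=
  IsPath E p ∧ p.head? = some X ∧ p.getLast? = some Y ∧
    (∀ i b, 0 < i → i + 1 < p.length → p[i]? = some b → b ∈ N →
      CollidesAt E p i) ∧
    (∀ i b, 0 < i → i + 1 < p.length → p[i]? = some b → CollidesAt E p i →
      b ∈ Ancestors E X ∪ Ancestors E Y)

lemma Acyclic.wellFounded {V : Type} [Finite V] {E : V → V → Prop} (h : Acyclic E) :
    WellFounded E := by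
  have : Std.Irrefl (Relation.TransGen E) := ⟨h⟩
  exact Subrelation.wf Relation.TransGen.single
    (Finite.wellFounded_of_trans_of_irrefl (Relation.TransGen E))

lemma Acyclic.asymm {V : Type} {E : V → V → Prop} (h : Acyclic E) {u v : V}
    (huv : E u v) : ¬ E v u :=
  fun hvu => h u (Relation.TransGen.tail (.single huv) hvu)

lemma mem_ancestors_of_edge {V : Type} {E : V → V → Prop} {X u v : V} (huv : E u v)
    (hv : v ∈ Ancestors E X) : u ∈ Ancestors E X :=
  Relation.ReflTransGen.head huv hv

/-- One move of an active walk relative to the conditioning set `S`.  A state `(v, b)` is the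
current vertex together with a flag telling whether the last edge points into `v`. -/
def ActiveStep {V : Type} (E : V → V → Prop) (S : Set V) (σ τ : V × Prop) : Prop :=
  (E σ.1 τ.1 ∧ τ.2 ∧ σ.1 ∉ S) ∨
    (E τ.1 σ.1 ∧ ¬ τ.2 ∧ ((¬ σ.2 ∧ σ.1 ∉ S) ∨ (σ.2 ∧ ∃ s ∈ S, σ.1 ∈ Ancestors E s)))

namespace ActiveStep

variable {V : Type} {E : V → V → Prop} {S : Set V}

lemma into_descendant_or_ancestor {v : V} {σ τ : V × Prop}
    (h : Relation.ReflTransGen (ActiveStep E S) σ τ)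
    (hσ : σ.2 ∧ Relation.ReflTransGen E v σ.1) :
    (τ.2 ∧ Relation.ReflTransGen E v τ.1) ∨ ∃ s ∈ S, v ∈ Ancestors E s := by
  induction h with
  | refl => exact Or.inl hσ
  | tail _ hstep ih =>
    rcases ih with ⟨hin, hdesc⟩ | hanc
    · rcases hstep with ⟨he, hin', _⟩ | ⟨_, _, ⟨hout, _⟩ | ⟨_, s, hs, hanc⟩⟩
      · exact Or.inl ⟨hin', hdesc.tail he⟩
      · exact absurd hin hout
      · exact Or.inr ⟨s, hs, hdesc.trans hanc⟩
    · exact Or.inr hanc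

/-- A closed active walk can be cut out. -/
lemma of_loop {v : V} {b b' : Prop} {τ : V × Prop}
    (hloop : Relation.TransGen (ActiveStep E S) (v, b) (v, b'))
    (hstep : ActiveStep E S (v, b') τ) : ActiveStep E S (v, b) τ := by
  rcases hstep with h | ⟨he, hτ, hv⟩
  · exact Or.inl h
  · refine Or.inr ⟨he, hτ, ?_⟩
    obtain ⟨ρ, hfirst, hrest⟩ := Relation.TransGen.head'_iff.mp hloop
    by_cases hb : b
    · refine Or.inr ⟨hb, ?_⟩
      rcases hv with ⟨hb', _⟩ | ⟨_, hanc⟩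
      · rcases hfirst with ⟨hvρ, hin, _⟩ | ⟨_, _, ⟨hout, _⟩ | ⟨_, hanc⟩⟩
        · rcases into_descendant_or_ancestor hrest ⟨hin, .single hvρ⟩ with h | h
          · exact absurd h.1 hb'
          · exact h
        · exact absurd hb hout
        · exact hanc
      · exact hanc
    · refine Or.inl ⟨hb, ?_⟩
      rcases hfirst with ⟨_, _, h⟩ | ⟨_, _, ⟨_, h⟩ | ⟨hin, _⟩⟩
      · exact h
      · exact h
      · exact absurd hin hb

end ActiveStep

/-- Vertex-simple active walks from `Y`, listed with the current vertex first. -/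
inductive ActiveTrace {V : Type} (E : V → V → Prop) (S : Set V) (Y : V) :
    List V → Prop → Prop
  | start : ActiveTrace E S Y [Y] False
  | step {v w : V} {l : List V} {b b' : Prop} :
      ActiveTrace E S Y (v :: l) b → ActiveStep E S (v, b) (w, b') → w ∉ v :: l →
      ActiveTrace E S Y (w :: v :: l) b'

namespace ActiveTrace

variable {V : Type} {E : V → V → Prop} {S : Set V} {Y : V}

lemma truncate {p : List V} {b : Prop} (h : ActiveTrace E S Y p b) :
    ∀ v l, p = v :: l → ∀ w ∈ p, ∃ l' b', ActiveTrace E S Y (w :: l') b' ∧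
      Relation.ReflTransGen (ActiveStep E S) (w, b') (v, b) := by
  induction h with
  | start =>
    rintro v l hp w hw
    obtain ⟨rfl, rfl⟩ := List.cons.inj hp
    obtain rfl := List.mem_singleton.mp hw
    exact ⟨[], False, .start, .refl⟩
  | @step v₀ w₀ l₀ b₀ b₁ htr hstep hnot ih =>
    rintro v l hp w hw
    obtain ⟨rfl, rfl⟩ := List.cons.inj hp
    rcases List.mem_cons.mp hw with rfl | hw
    · exact ⟨_, _, .step htr hstep hnot, .refl⟩
    · obtain ⟨l', b', h₁, h₂⟩ := ih v₀ l₀ rfl w hw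
      exact ⟨l', b', h₁, h₂.tail hstep⟩

lemma exists_of_reachable {σ : V × Prop}
    (h : Relation.ReflTransGen (ActiveStep E S) (Y, False) σ) :
    ∃ l b, ActiveTrace E S Y (σ.1 :: l) b ∧
      ∀ τ, ActiveStep E S σ τ → ActiveStep E S (σ.1, b) τ := by
  induction h with
  | refl => exact ⟨[], False, .start, fun _ h => h⟩
  | @tail σ τ _ hstep ih =>
    obtain ⟨l, b, htr, hdom⟩ := ih
    by_cases hmem : τ.1 ∈ σ.1 :: l
    · obtain ⟨l', b', h₁, h₂⟩ := htr.truncate _ _ rfl _ hmem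
      exact ⟨l', b', h₁, fun ρ hρ =>
        ActiveStep.of_loop (b' := τ.2) (Relation.TransGen.tail' h₂ (hdom τ hstep)) hρ⟩
    · exact ⟨_, τ.2, .step htr (hdom τ hstep) hmem, fun _ h => h⟩

lemma isPath {p : List V} {b : Prop} (h : ActiveTrace E S Y p b) : IsPath E p := by
  induction h with
  | start => exact ⟨List.isChain_singleton _, List.nodup_singleton _⟩
  | step _ hstep hnot ih =>
    refine ⟨List.isChain_cons_cons.mpr ⟨?_, ih.1⟩, List.nodup_cons.mpr ⟨hnot, ih.2⟩⟩
    rcases hstep with h | h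
    · exact Or.inr h.1
    · exact Or.inl h.1

lemma getLast?_eq {p : List V} {b : Prop} (h : ActiveTrace E S Y p b) :
    p.getLast? = some Y := by
  induction h with
  | start => rfl
  | step _ _ _ ih => rwa [List.getLast?_cons_cons]

lemma edge_of_cons_cons {v u : V} {l : List V} {b : Prop}
    (h : ActiveTrace E S Y (v :: u :: l) b) : (b ∧ E u v) ∨ (¬ b ∧ E v u) := by
  cases h with
  | step _ hstep _ =>
    rcases hstep with h | h
    · exact Or.inl ⟨h.2.1, h.1⟩
    · exact Or.inr ⟨h.2.1, h.1⟩

end ActiveTrace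

lemma collidesAt_cons {V : Type} {E : V → V → Prop} (w : V) (p : List V) (i : ℕ) :
    CollidesAt E (w :: p) (i + 2) ↔ CollidesAt E p (i + 1) := by
  simp [CollidesAt]

lemma collidesAt_one {V : Type} {E : V → V → Prop} (w v u : V) (l : List V) :
    CollidesAt E (w :: v :: u :: l) 1 ↔ E w v ∧ E u v := by
  simp [CollidesAt]

lemma ActiveTrace.not_blocked {V : Type} {E : V → V → Prop} {S : Set V} {Y : V}
    (hacyc : Acyclic E) {p : List V} {b : Prop}
    (h : ActiveTrace E S Y p b) : ¬ Blocked E S p := by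
  induction h with
  | start =>
    rintro ⟨i, _, hi, hlen, _⟩
    simp at hlen
  | @step v w l b b' htr hstep hnot ih =>
    rintro ⟨i, a, hi, hlen, ha, hblock⟩
    match i, hi with
    | 1, _ =>
      match l with
      | [] => simp at hlen
      | u :: l =>
        obtain rfl : v = a := by simpa using ha
        rw [collidesAt_one] at hblock
        rcases htr.edge_of_cons_cons with ⟨hb, huv⟩ | ⟨hb, hvu⟩
        · rcases hstep with ⟨hvw, _, hvS⟩ | ⟨hwv, _, ⟨hnb, _⟩ | ⟨_, s, hs, hanc⟩⟩
          · rcases hblock with h | h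
            · exact hvS h.2
            · exact hacyc.asymm hvw h.1.1
          · exact hnb hb
          · rcases hblock with h | h
            · exact h.1 ⟨hwv, huv⟩
            · exact h.2.2 s hs hanc
        · have hvS : v ∉ S := by
            rcases hstep with h | ⟨_, _, h | h⟩
            · exact h.2.2
            · exact h.2
            · exact absurd h.1 hb
          rcases hblock with h | h
          · exact hvS h.2
          · exact hacyc.asymm hvu h.1.2
    | i + 2, _ =>
      rw [collidesAt_cons] at hblock
      exact ih ⟨i + 1, a, Nat.succ_pos i, Nat.lt_of_succ_lt_succ hlen, by simpa using ha, hblock⟩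

lemma DSep.not_reachable {V : Type} {E : V → V → Prop} (hacyc : Acyclic E) {X Y : V}
    {S : Set V} (h : DSep E X Y S) (b : Prop) :
    ¬ Relation.ReflTransGen (ActiveStep E S) (Y, False) (X, b) := by
  intro hreach
  obtain ⟨l, b', htr, -⟩ := ActiveTrace.exists_of_reachable hreach
  exact htr.not_blocked hacyc (h _ htr.isPath rfl htr.getLast?_eq)

/-- Adjacency in the moral graph of the subgraph induced by `A`, with both endpoints in `B`. -/
def MoralAdj {V : Type} (E : V → V → Prop) (A B : Set V) (u v : V) : Prop :=
  u ∈ B ∧ v ∈ B ∧ (E u v ∨ E v u ∨ ∃ w ∈ A, E u w ∧ E v w)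

lemma MoralAdj.symm {V : Type} {E : V → V → Prop} {A B : Set V} {u v : V}
    (h : MoralAdj E A B u v) : MoralAdj E A B v u := by
  obtain ⟨hu, hv, h | h | ⟨w, hw, h₁, h₂⟩⟩ := h
  · exact ⟨hv, hu, Or.inr (Or.inl h)⟩
  · exact ⟨hv, hu, Or.inl h⟩
  · exact ⟨hv, hu, Or.inr (Or.inr ⟨w, hw, h₂, h₁⟩)⟩

section MoralConnection

variable {V : Type} {E : V → V → Prop} {S : Set V} {X Y : V}

lemma reachable_down {v : V} {b : Prop}
    (hreach : Relation.ReflTransGen (ActiveStep E S) (Y, False) (v, b))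
    (hanc : v ∈ Ancestors E X) (hS : ∀ s ∈ S, v ∉ Ancestors E s) :
    ∃ b', Relation.ReflTransGen (ActiveStep E S) (Y, False) (X, b') := by
  induction hanc using Relation.ReflTransGen.head_induction_on generalizing b with
  | refl => exact ⟨b, hreach⟩
  | @head v u hvu _ ih =>
    have hvS : v ∉ S := fun h => hS v h .refl
    exact ih (b := True) (hreach.tail (Or.inl ⟨hvu, trivial, hvS⟩))
      fun s hs h => hS s hs (mem_ancestors_of_edge hvu h)

lemma reachable_up {v : V} (hanc : v ∈ Ancestors E Y) (hS : ∀ s ∈ S, v ∉ Ancestors E s) :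
    Relation.ReflTransGen (ActiveStep E S) (Y, False) (v, False) := by
  induction hanc using Relation.ReflTransGen.head_induction_on with
  | refl => exact .refl
  | @head v u hvu _ ih =>
    have hS' : ∀ s ∈ S, u ∉ Ancestors E s :=
      fun s hs h => hS s hs (mem_ancestors_of_edge hvu h)
    exact (ih hS').tail
      (Or.inr ⟨hvu, not_false, Or.inl ⟨not_false, fun h => hS' u h .refl⟩⟩)

/-- A reached vertex of the ancestral set can be left towards any of its parents, unless the
target is already reachable. -/
lemma reachable_parent {u v : V} {b : Prop}
    (hX : ∀ b', ¬ Relation.ReflTransGen (ActiveStep E S) (Y, False) (X, b'))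
    (hv : v ∈ Ancestors E X ∪ Ancestors E Y)
    (hreach : Relation.ReflTransGen (ActiveStep E S) (Y, False) (v, b))
    (hb : b ∨ v ∉ S) (huv : E u v) :
    Relation.ReflTransGen (ActiveStep E S) (Y, False) (u, False) := by
  by_cases hS : ∃ s ∈ S, v ∈ Ancestors E s
  · refine hreach.tail (Or.inr ⟨huv, not_false, ?_⟩)
    by_cases hb' : b
    · exact Or.inr ⟨hb', hS⟩
    · exact Or.inl ⟨hb', hb.resolve_left hb'⟩
  · push Not at hS
    rcases hv with hv | hv
    · obtain ⟨b', h⟩ := reachable_down hreach hv hS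
      exact absurd h (hX b')
    · exact (reachable_up hv hS).tail
        (Or.inr ⟨huv, not_false, Or.inl ⟨not_false, fun h => hS v h .refl⟩⟩)

lemma reachable_of_moral {B : Set V} (hB : ∀ v ∈ B, v ∈ Ancestors E X ∪ Ancestors E Y ∧ v ∉ S)
    (hX : ∀ b', ¬ Relation.ReflTransGen (ActiveStep E S) (Y, False) (X, b')) {v : V}
    (h : Relation.ReflTransGen (MoralAdj E (Ancestors E X ∪ Ancestors E Y) B) Y v) :
    ∃ b, Relation.ReflTransGen (ActiveStep E S) (Y, False) (v, b) := by
  induction h with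
  | refl => exact ⟨False, .refl⟩
  | @tail u v _ hadj ih =>
    obtain ⟨b, hreach⟩ := ih
    obtain ⟨hu, _, huv | hvu | ⟨w, hw, huw, hvw⟩⟩ := hadj
    · exact ⟨True, hreach.tail (Or.inl ⟨huv, trivial, (hB u hu).2⟩)⟩
    · exact ⟨False, reachable_parent hX (hB u hu).1 hreach (Or.inr (hB u hu).2) hvu⟩
    · have hreach_w : Relation.ReflTransGen (ActiveStep E S) (Y, False) (w, True) :=
        hreach.tail (Or.inl ⟨huw, trivial, (hB u hu).2⟩)
      exact ⟨False, reachable_parent hX hw hreach_w (Or.inl trivial) hvw⟩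

/-- Vertices `d`-separated by `S` are separated in the moral graph of their ancestors by any set
whose complement within the ancestors avoids `S`. -/
lemma DSep.not_moral_connected (hacyc : Acyclic E) (h : DSep E X Y S) {B : Set V}
    (hB : ∀ v ∈ B, v ∈ Ancestors E X ∪ Ancestors E Y ∧ v ∉ S) :
    ¬ Relation.ReflTransGen (MoralAdj E (Ancestors E X ∪ Ancestors E Y) B) X Y := by
  intro hconn
  have : Std.Symm (MoralAdj E (Ancestors E X ∪ Ancestors E Y) B) := ⟨fun _ _ h => h.symm⟩
  have hsymm := Relation.ReflTransGen.stdSymm.symm _ _ hconn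
  obtain ⟨b, hb⟩ := reachable_of_moral hB (h.not_reachable hacyc) hsymm
  exact h.not_reachable hacyc b hb

end MoralConnection

open Classical in
/-- Take the coordinates in `F` from `ω` and the others from `ω'`. -/
noncomputable def mixNoise {V : Type} {A : V → Type} (F : Set V) (ω ω' : ∀ v, A v) : ∀ v, A v :=
  fun v => if v ∈ F then ω v else ω' v

section MixNoise

variable {V : Type} {A : V → Type} {F : Set V} {v : V}

lemma mixNoise_of_mem (ω ω' : ∀ v, A v) (h : v ∈ F) : mixNoise F ω ω' v = ω v := if_pos h

lemma mixNoise_of_notMem (ω ω' : ∀ v, A v) (h : v ∉ F) : mixNoise F ω ω' v = ω' v := if_neg h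

lemma mixNoise_mixNoise (ω ω' : ∀ v, A v) :
    mixNoise F (mixNoise F ω ω') (mixNoise F ω' ω) = ω := by
  funext v
  by_cases h : v ∈ F <;> simp [mixNoise, h]

end MixNoise

namespace SEM

variable {V : Type} [Fintype V] [DecidableEq V] {E : V → V → Prop}
  {D : V → Type} [∀ v, Fintype (D v)] [∀ v, DecidableEq (D v)]

lemma W_mixNoise_mul (M : SEM V E D) (F : Set V) (ω ω' : M.Ω) :
    M.W (mixNoise F ω ω') * M.W (mixNoise F ω' ω) = M.W ω * M.W ω' := by
  simp only [W, ← Finset.prod_mul_distrib]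
  refine Finset.prod_congr rfl fun v _ => ?_
  by_cases h : v ∈ F
  · simp [mixNoise, h]
  · simp [mixNoise, h, mul_comm]

/-- Exchanging noise coordinates between two independent copies preserves products of
probabilities. -/
lemma prob_mul_prob_eq_of_mixNoise (M : SEM V E D) (g : M.Ω → ∀ v, D v) (F : Set V)
    {P₁ P₂ Q₁ Q₂ : (∀ v, D v) → Prop}
    (hPQ : ∀ ω ω' : M.Ω, P₁ (g ω) → P₂ (g ω') →
      Q₁ (g (mixNoise F ω ω')) ∧ Q₂ (g (mixNoise F ω' ω)))
    (hQP : ∀ ω ω' : M.Ω, Q₁ (g ω) → Q₂ (g ω') →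
      P₁ (g (mixNoise F ω ω')) ∧ P₂ (g (mixNoise F ω' ω))) :
    M.prob g P₁ * M.prob g P₂ = M.prob g Q₁ * M.prob g Q₂ := by
  classical
  simp only [prob, Finset.sum_mul_sum, ← Finset.sum_product']
  refine Finset.sum_nbij'
    (fun q => (mixNoise F q.1 q.2, mixNoise F q.2 q.1))
    (fun q => (mixNoise F q.1 q.2, mixNoise F q.2 q.1)) ?_ ?_ ?_ ?_ ?_
  · rintro ⟨ω, ω'⟩ h
    simp only [Finset.mem_product, Finset.mem_filter, Finset.mem_univ, true_and] at h ⊢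
    exact hPQ ω ω' h.1 h.2
  · rintro ⟨ω, ω'⟩ h
    simp only [Finset.mem_product, Finset.mem_filter, Finset.mem_univ, true_and] at h ⊢
    exact hQP ω ω' h.1 h.2
  · rintro ⟨ω, ω'⟩ _
    simp only [mixNoise_mixNoise]
  · rintro ⟨ω, ω'⟩ _
    simp only [mixNoise_mixNoise]
  · intro q _
    exact (M.W_mixNoise_mul F q.1 q.2).symm

/-- If two noise outcomes produce the same values on `T`, the solution for the mixed noise follows
the first one on `K` and the second one on `L`, provided `T` shields `K` and `L` from each other. -/
lemma solution_mixNoise (M : SEM V E D) (hacyc : Acyclic E) {g : M.Ω → ∀ v, D v}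
    (hg : M.IsObsSolution g) {C : Set V} (hCroot : ∀ v ∈ C, IsRoot E v) {c : ∀ v, D v}
    {K L T F : Set V} (hKF : K ⊆ F) (hLF : Disjoint L F) (hCF : Disjoint C F)
    (hF : ∀ v ∈ K ∪ T, v ∈ F → ∀ (w w' : ∀ u, D u) (n : Fin (M.noiseCard v)),
      (∀ u ∈ C, w u = c u) → (∀ u ∈ C, w' u = c u) →
      (∀ u ∈ K ∪ T, E u v → w u = w' u) → M.f v w n = M.f v w' n)
    (hF' : ∀ v ∈ L ∪ T, v ∉ F → ∀ u, E u v → u ∈ L ∪ T)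
    {ω ω' : M.Ω} (hT : ∀ v ∈ T, g ω v = g ω' v)
    (hC : ∀ v ∈ C, g ω v = c v) (hC' : ∀ v ∈ C, g ω' v = c v) :
    (∀ v ∈ K ∪ T, g (mixNoise F ω ω') v = g ω v) ∧
      (∀ v ∈ L ∪ T, g (mixNoise F ω ω') v = g ω' v) := by
  have hCmix : ∀ v ∈ C, g (mixNoise F ω ω') v = c v := by
    intro v hv
    rw [← hC' v hv, hg _ v, hg ω' v, mixNoise_of_notMem _ _ (Set.disjoint_left.mp hCF hv)]
    exact M.f_parents v _ _ _ fun u hu => absurd hu (hCroot v hv u)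
  suffices h : ∀ v, (v ∈ K ∪ T → g (mixNoise F ω ω') v = g ω v) ∧
      (v ∈ L ∪ T → g (mixNoise F ω ω') v = g ω' v) from
    ⟨fun v => (h v).1, fun v => (h v).2⟩
  intro v
  induction v using hacyc.wellFounded.induction with
  | _ v ih =>
    have hin : v ∈ K ∪ T → v ∈ F → g (mixNoise F ω ω') v = g ω v := by
      intro hv hvF
      rw [hg _ v, hg ω v, mixNoise_of_mem _ _ hvF]
      exact hF v hv hvF _ _ _ hCmix hC fun u hu huv => (ih u huv).1 hu
    have hout : v ∈ L ∪ T → v ∉ F → g (mixNoise F ω ω') v = g ω' v := by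
      intro hv hvF
      rw [hg _ v, hg ω' v, mixNoise_of_notMem _ _ hvF]
      exact M.f_parents v _ _ _ fun u huv => (ih u huv).2 (hF' v hv hvF u huv)
    by_cases hvF : v ∈ F
    · refine ⟨fun hv => hin hv hvF, fun hv => ?_⟩
      have hvT : v ∈ T := hv.resolve_left fun h => Set.disjoint_left.mp hLF h hvF
      rw [hin (Or.inr hvT) hvF, hT v hvT]
    · refine ⟨fun hv => ?_, fun hv => hout hv hvF⟩
      have hvT : v ∈ T := hv.resolve_left fun h => hvF (hKF h)
      rw [hout (Or.inr hvT) hvF, hT v hvT]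

end SEM

/-- Theorem 2 of the paper.  Let `(Y,X)` be an edge of the
causal DAG, `C ⊆ Λ_G` a set of observed-root control variables, with strictly
positive observational distribution over the observed variables `N`, and suppose
that under `do(C = c)` the structural function of `X` does not depend on `Y`.
Let `H` be the DAG obtained by removing the edge `(Y,X)`.  If (I) `X, Y ∈ N` and
(II) `X` and `Y` are d-separable in `H` by some subset of `N`, then the
context-specific independence
`X ⟂ Y | C = c, (Anc_{{X,Y}} ∩ N \ C) \ {X,Y}` holds in `P^M`,
where ancestors are taken in `H`. -/
theorem csi_learnable_from_observations
    {V : Type} [Fintype V] [DecidableEq V] {E : V → V → Prop}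
    {D : V → Type} [∀ v, Fintype (D v)] [∀ v, DecidableEq (D v)]
    (M : SEM V E D) (hacyc : Acyclic E)
    (N C : Set V) (hCN : C ⊆ N) (hCroot : ∀ v ∈ C, IsRoot E v)
    (g₀ : M.Ω → ∀ v, D v) (hg₀ : M.IsObsSolution g₀)
    (hpos : ∀ (a : ∀ v, D v), 0 < M.prob g₀ (fun w => ∀ v ∈ N, w v = a v))
    (X Y : V) (hYX : E Y X) (c : ∀ v, D v)
    (hf : ∀ (w w' : ∀ u, D u) (n : Fin (M.noiseCard X)),
      (∀ v ∈ C, w v = c v) → (∀ v ∈ C, w' v = c v) →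
      (∀ u, u ≠ Y → w u = w' u) → M.f X w n = M.f X w' n)
    (hXN : X ∈ N) (hYN : Y ∈ N)
    (hdsep : ∃ S ⊆ N \ {X, Y},
      DSep (fun u v => E u v ∧ ¬(u = Y ∧ v = X)) X Y S) :
    M.CondIndepOn g₀ X Y
      ((((Ancestors (fun u v => E u v ∧ ¬(u = Y ∧ v = X)) X ∪
          Ancestors (fun u v => E u v ∧ ¬(u = Y ∧ v = X)) Y) ∩ N) \ C) \ {X, Y})
      (fun w => ∀ v ∈ C, w v = c v) := by
  set H : V → V → Prop := fun u v => E u v ∧ ¬(u = Y ∧ v = X)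
  set A : Set V := Ancestors H X ∪ Ancestors H Y
  set Z : Set V := ((A ∩ N) \ C) \ {X, Y}
  obtain ⟨S, hSN, hsep⟩ := hdsep
  have hacycH : Acyclic H := fun v hv => hacyc v (Relation.TransGen.mono (fun _ _ h => h.1) _ _ hv)
  have hXC : X ∉ C := fun h => hCroot X h Y hYX
  have hXA : X ∈ A := Or.inl .refl
  have hYA : Y ∈ A := Or.inr .refl
  have hAH : ∀ {u v}, H u v → v ∈ A → u ∈ A := fun huv hv =>
    hv.imp (mem_ancestors_of_edge huv) (mem_ancestors_of_edge huv)
  let T : Set V := Z ∪ C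
  let B : Set V := A \ T
  let K : Set V := {v | Relation.ReflTransGen (MoralAdj H A B) X v}
  let L : Set V := B \ K
  let F : Set V := {v | v ∈ K ∨ ∃ u ∈ K, H u v}
  have hXB : X ∈ B := ⟨hXA, fun h => h.elim (fun h => h.2 (Or.inl rfl)) hXC⟩
  have hXK : X ∈ K := Relation.ReflTransGen.refl
  have hKB : K ⊆ B := by
    intro v hv
    rcases Relation.ReflTransGen.cases_tail hv with rfl | ⟨_, _, h⟩
    · exact hXB
    · exact h.2.1
  have hYK : Y ∉ K := by
    refine hsep.not_moral_connected hacycH fun v hv => ⟨hv.1, fun hvS => hv.2 ?_⟩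
    by_cases hvC : v ∈ C
    · exact Or.inr hvC
    · exact Or.inl ⟨⟨⟨hv.1, (hSN hvS).1⟩, hvC⟩, (hSN hvS).2⟩
  have hYLT : Y ∈ L ∪ T := by
    by_cases hYT : Y ∈ T
    · exact Or.inr hYT
    · exact Or.inl ⟨⟨hYA, hYT⟩, hYK⟩
  have hKadj : ∀ {u v}, u ∈ K → v ∈ A →
      (H u v ∨ H v u ∨ ∃ w ∈ A, H u w ∧ H v w) → v ∈ K ∪ T := by
    intro u v hu hv h
    by_cases hvT : v ∈ T
    · exact Or.inr hvT
    · exact Or.inl (Relation.ReflTransGen.tail hu ⟨hKB hu, ⟨hv, hvT⟩, h⟩)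
  have hLF : Disjoint L F := by
    refine Set.disjoint_left.mpr fun v hvL hvF => ?_
    rcases hvF with hvK | ⟨u, hu, huv⟩
    · exact hvL.2 hvK
    · exact (hKadj hu hvL.1.1 (Or.inl huv)).elim hvL.2 hvL.1.2
  have hCF : Disjoint C F := by
    refine Set.disjoint_left.mpr fun v hvC hvF => ?_
    rcases hvF with hvK | ⟨u, _, huv⟩
    · exact (hKB hvK).2 (Or.inr hvC)
    · exact hCroot v hvC u huv.1
  have hparF : ∀ v ∈ K ∪ T, v ∈ F → ∀ u, H u v → u ∈ K ∪ T := by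
    intro v hv hvF u huv
    have hvA : v ∈ A := by
      rcases hv with hv | hv | hv
      · exact (hKB hv).1
      · exact hv.1.1.1
      · exact absurd hvF (Set.disjoint_left.mp hCF hv)
    rcases hvF with hvK | ⟨u', hu', hu'v⟩
    · exact hKadj hvK (hAH huv hvA) (Or.inr (Or.inl huv))
    · exact hKadj hu' (hAH huv hvA) (Or.inr (Or.inr ⟨v, hvA, hu'v, huv⟩))
  have hF : ∀ v ∈ K ∪ T, v ∈ F → ∀ (w w' : ∀ u, D u) (n : Fin (M.noiseCard v)),
      (∀ u ∈ C, w u = c u) → (∀ u ∈ C, w' u = c u) →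
      (∀ u ∈ K ∪ T, E u v → w u = w' u) → M.f v w n = M.f v w' n := by
    intro v hv hvF w w' n hw hw' heq
    by_cases hvX : v = X
    · subst hvX
      by_cases hYT : Y ∈ K ∪ T
      · refine M.f_parents v w w' n fun u huv => heq u ?_ huv
        by_cases huY : u = Y
        · exact huY ▸ hYT
        · exact hparF v hv hvF u ⟨huv, fun h => huY h.1⟩
      · have hYC : ∀ u ∈ C, u ≠ Y := fun u hu h => hYT (h ▸ Or.inr (Or.inr hu))
        rw [hf w (Function.update w Y (w' Y)) n hw
          (fun u hu => by rw [Function.update_of_ne (hYC u hu), hw u hu])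
          (fun u hu => (Function.update_of_ne hu _ _).symm)]
        refine M.f_parents v _ _ n fun u huv => ?_
        by_cases huY : u = Y
        · subst huY
          exact Function.update_self _ _ _
        · rw [Function.update_of_ne huY]
          exact heq u (hparF v hv hvF u ⟨huv, fun h => huY h.1⟩) huv
    · exact M.f_parents v w w' n fun u huv =>
        heq u (hparF v hv hvF u ⟨huv, fun h => hvX h.2⟩) huv
  have hF' : ∀ v ∈ L ∪ T, v ∉ F → ∀ u, E u v → u ∈ L ∪ T := by
    intro v hv hvF u huv
    have hvX : v ≠ X := fun h => hvF (Or.inl (h ▸ hXK))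
    have huv' : H u v := ⟨huv, fun h => hvX h.2⟩
    have hvA : v ∈ A := by
      rcases hv with hv | hv | hv
      · exact hv.1.1
      · exact hv.1.1.1
      · exact absurd huv (hCroot v hv u)
    by_cases huT : u ∈ T
    · exact Or.inr huT
    · exact Or.inl ⟨⟨hAH huv' hvA, huT⟩, fun huK => hvF (Or.inr ⟨u, huK, huv'⟩)⟩
  have hmix : ∀ (s : ∀ v, D v) (ω ω' : M.Ω),
      ((∀ v ∈ Z, g₀ ω v = s v) ∧ ∀ v ∈ C, g₀ ω v = c v) →
      ((∀ v ∈ Z, g₀ ω' v = s v) ∧ ∀ v ∈ C, g₀ ω' v = c v) →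
      ((∀ v ∈ Z, g₀ (mixNoise F ω ω') v = s v) ∧ ∀ v ∈ C, g₀ (mixNoise F ω ω') v = c v) ∧
        g₀ (mixNoise F ω ω') X = g₀ ω X ∧ g₀ (mixNoise F ω ω') Y = g₀ ω' Y := by
    intro s ω ω' h h'
    have hT : ∀ v ∈ T, g₀ ω v = g₀ ω' v := by
      rintro v (hv | hv)
      · rw [h.1 v hv, h'.1 v hv]
      · rw [h.2 v hv, h'.2 v hv]
    obtain ⟨h₁, h₂⟩ := M.solution_mixNoise hacyc hg₀ hCroot (K := K) (fun v hv => Or.inl hv)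
      hLF hCF hF hF' hT h.2 h'.2
    exact ⟨⟨fun v hv => (h₁ v (Or.inr (Or.inl hv))).trans (h.1 v hv),
      fun v hv => (h₁ v (Or.inr (Or.inr hv))).trans (h.2 v hv)⟩,
      h₁ X (Or.inl hXK), h₂ Y hYLT⟩
  intro x y s
  refine M.prob_mul_prob_eq_of_mixNoise g₀ F ?_ ?_
  · rintro ω ω' ⟨hx, hy, hctx⟩ hctx'
    obtain ⟨h₁, h₂, _⟩ := hmix s ω ω' hctx hctx'
    obtain ⟨h₃, _, h₄⟩ := hmix s ω' ω hctx' hctx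
    exact ⟨⟨h₂.trans hx, h₁⟩, h₄.trans hy, h₃⟩
  · rintro ω ω' ⟨hx, hctx⟩ ⟨hy, hctx'⟩
    obtain ⟨h₁, h₂, h₃⟩ := hmix s ω ω' hctx hctx'
    exact ⟨⟨h₂.trans hx, h₃.trans hy, h₁⟩, (hmix s ω' ω hctx' hctx).1⟩
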